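/- For every finite connected simple graph G and every positive integer k, the k-fold cartesian product G^{□k} = G □ G □ ⋯ □ G (k factors) satisfies π(G^{□k}) < (π(G) + |G|)^k. -/

import Mathlib

/-- A single pebbling move on `G`: remove two pebbles from a vertex `u`
and place one pebble on an adjacent vertex `v`. -/
def PebblingStep {V : Type*} [DecidableEq V] (G : SimpleGraph V) (C C' : V → ℕ) : Prop :=
  ∃ u v, G.Adj u v ∧ 2 ≤ C u ∧
    C' = Function.update (Function.update C u (C u - 2)) v (C v + 1)

/-- Configuration `C` is `k`-fold `r`-solvable on `G`: some sequence of pebbling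
moves results in at least `k` pebbles on `r`. -/
def PebbSolvable {V : Type*} [DecidableEq V] (G : SimpleGraph V) (C : V → ℕ) (r : V)
    (k : ℕ) : Prop :=
  ∃ C', Relation.ReflTransGen (PebblingStep G) C C' ∧ k ≤ C' r

/-- The `k`-fold pebbling number of `G`: the least `n` such that for every root `r`,
every configuration of size at least `n` is `k`-fold `r`-solvable. -/
noncomputable def kPebblingNumber {V : Type*} [Fintype V] [DecidableEq V]
    (G : SimpleGraph V) (k : ℕ) : ℕ :=
  sInf {n | ∀ (r : V) (C : V → ℕ), n ≤ ∑ v, C v → PebbSolvable G C r k}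

/-- The pebbling number of `G`. -/
noncomputable def pebblingNumber {V : Type*} [Fintype V] [DecidableEq V]
    (G : SimpleGraph V) : ℕ :=
  kPebblingNumber G 1

/-- The vertex type of the cartesian product of `n + 1` copies of a graph on `V`. -/
def boxPowVertex (V : Type u) : ℕ → Type u
  | 0 => V
  | n + 1 => V × boxPowVertex V n

instance boxPowVertexFintype (V : Type u) [Fintype V] :
    ∀ n, Fintype (boxPowVertex V n)
  | 0 => inferInstanceAs (Fintype V)
  | n + 1 =>
    letI := boxPowVertexFintype V n
    inferInstanceAs (Fintype (V × boxPowVertex V n))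

instance boxPowVertexDecidableEq (V : Type u) [DecidableEq V] :
    ∀ n, DecidableEq (boxPowVertex V n)
  | 0 => inferInstanceAs (DecidableEq V)
  | n + 1 =>
    letI := boxPowVertexDecidableEq V n
    inferInstanceAs (DecidableEq (V × boxPowVertex V n))

/-- The cartesian (box) product of `n + 1` copies of `G`. -/
def boxPow {V : Type u} (G : SimpleGraph V) : (n : ℕ) → SimpleGraph (boxPowVertex V n)
  | 0 => G
  | n + 1 => G.boxProd (boxPow G n)

theorem exists_le_sum_eq {V : Type*} [Fintype V] {C : V → ℕ} {n : ℕ} (h : n ≤ ∑ v, C v) :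
    ∃ D ≤ C, ∑ v, D v = n := by
  classical
  induction n with
  | zero => exact ⟨0, zero_le, by simp⟩
  | succ n ih =>
    obtain ⟨D, hD, hn⟩ := ih (by omega)
    obtain ⟨v, -, hv⟩ := Finset.exists_lt_of_sum_lt (s := Finset.univ) (f := D) (g := C)
      (by omega)
    refine ⟨D + Pi.single v 1, fun w => ?_, by simp [Finset.sum_add_distrib, hn]⟩
    by_cases hw : w = v
    · subst hw
      simpa using hv
    · simpa [hw] using hD w

/-- The image of a configuration under a map of vertices. -/
def pushConfig {V W : Type*} [Fintype V] [DecidableEq W] (f : V → W) (C : V → ℕ) : W → ℕ :=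
  fun w => ∑ v, if f v = w then C v else 0

theorem pushConfig_add {V W : Type*} [Fintype V] [DecidableEq W] (f : V → W)
    (C D : V → ℕ) :
    pushConfig f (C + D) = pushConfig f C + pushConfig f D := by
  funext w
  simp only [pushConfig, Pi.add_apply, ← Finset.sum_add_distrib]
  exact Finset.sum_congr rfl fun v _ => by split_ifs <;> rfl

section Moves

variable {V W : Type*} [DecidableEq V] [DecidableEq W] {G : SimpleGraph V}

theorem pebblingStep_add_single {u v : V} (h : G.Adj u v) (D : V → ℕ) :
    PebblingStep G (D + Pi.single u 2) (D + Pi.single v 1) := by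
  refine ⟨u, v, h, by simp, ?_⟩
  funext x
  have := h.ne
  by_cases hv : x = v
  · subst hv
    simp [h.ne']
  · by_cases hu : x = u
    · subst hu
      simp [hv]
    · simp [hu, hv]

theorem PebblingStep.exists_add_single {C C' : V → ℕ} (h : PebblingStep G C C') :
    ∃ (u v : V) (D : V → ℕ), G.Adj u v ∧ C = D + Pi.single u 2 ∧ C' = D + Pi.single v 1 := by
  obtain ⟨u, v, huv, h2, rfl⟩ := h
  refine ⟨u, v, Function.update C u (C u - 2), huv, ?_, ?_⟩
  · funext x
    by_cases hu : x = u
    · subst hu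
      simp [h2]
    · simp [hu]
  · funext x
    by_cases hv : x = v
    · subst hv
      simp [huv.ne']
    · simp [hv]

theorem PebblingStep.add_right {C C' : V → ℕ} (h : PebblingStep G C C') (D : V → ℕ) :
    PebblingStep G (C + D) (C' + D) := by
  obtain ⟨u, v, E, huv, rfl, rfl⟩ := h.exists_add_single
  rw [add_right_comm E _ D, add_right_comm E _ D]
  exact pebblingStep_add_single huv _

theorem reflTransGen_pebblingStep_add {C C' D D' : V → ℕ}
    (hC : Relation.ReflTransGen (PebblingStep G) C C')
    (hD : Relation.ReflTransGen (PebblingStep G) D D') :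
    Relation.ReflTransGen (PebblingStep G) (C + D) (C' + D') := by
  refine (hC.lift (· + D) fun _ _ h => h.add_right D).trans (hD.lift (C' + ·) fun _ _ h => ?_)
  simpa only [add_comm C'] using h.add_right C'

theorem reflTransGen_pebblingStep_sum {ι : Type*} (s : Finset ι) {C C' : ι → V → ℕ}
    (h : ∀ i, Relation.ReflTransGen (PebblingStep G) (C i) (C' i)) :
    Relation.ReflTransGen (PebblingStep G) (∑ i ∈ s, C i) (∑ i ∈ s, C' i) := by
  classical
  induction s using Finset.induction_on with
  | empty => exact .refl
  | insert i s hi ih =>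
    rw [Finset.sum_insert hi, Finset.sum_insert hi]
    exact reflTransGen_pebblingStep_add (h i) ih

theorem pushConfig_single [Fintype V] (f : V → W) (u : V) (n : ℕ) :
    pushConfig f (Pi.single u n) = Pi.single (f u) n := by
  funext w
  rw [pushConfig, Finset.sum_eq_single u]
  · simp [Pi.single_apply, eq_comm]
  · intro v _ hv
    simp [hv]
  · simp

theorem pushConfig_apply [Fintype V] {f : V → W} (hf : Function.Injective f) (C : V → ℕ)
    (v : V) : pushConfig f C (f v) = C v := by
  simp [pushConfig, hf.eq_iff]

theorem PebblingStep.push [Fintype V] {H : SimpleGraph W} (f : G →g H) {C C' : V → ℕ}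
    (h : PebblingStep G C C') : PebblingStep H (pushConfig f C) (pushConfig f C') := by
  obtain ⟨u, v, D, huv, rfl, rfl⟩ := h.exists_add_single
  simp only [pushConfig_add, pushConfig_single]
  exact pebblingStep_add_single (f.map_adj huv) _

theorem PebbSolvable.mono {C D : V → ℕ} {r : V} {k : ℕ} (h : PebbSolvable G C r k)
    (hCD : C ≤ D) : PebbSolvable G D r k := by
  obtain ⟨C', hC', hk⟩ := h
  refine ⟨C' + (D - C), ?_, hk.trans (Nat.le_add_right _ _)⟩
  simpa only [add_tsub_cancel_of_le hCD] using
    reflTransGen_pebblingStep_add hC' (.refl (a := D - C))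

theorem PebbSolvable.add {C D : V → ℕ} {r : V} {k l : ℕ} (hC : PebbSolvable G C r k)
    (hD : PebbSolvable G D r l) : PebbSolvable G (C + D) r (k + l) := by
  obtain ⟨C', hC', hk⟩ := hC
  obtain ⟨D', hD', hl⟩ := hD
  exact ⟨C' + D', reflTransGen_pebblingStep_add hC' hD', add_le_add hk hl⟩

theorem PebbSolvable.push [Fintype V] {H : SimpleGraph W} (f : G →g H)
    (hf : Function.Injective f) {C : V → ℕ} {r : V} {k : ℕ} (h : PebbSolvable G C r k) :
    PebbSolvable H (pushConfig f C) (f r) k := by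
  obtain ⟨C', hC', hk⟩ := h
  exact ⟨pushConfig f C', hC'.lift _ fun _ _ h => h.push f, by rwa [pushConfig_apply hf]⟩

theorem PebbSolvable.of_reflTransGen {C C' : V → ℕ} {r : V} {k : ℕ}
    (hC : Relation.ReflTransGen (PebblingStep G) C C') (h : PebbSolvable G C' r k) :
    PebbSolvable G C r k := by
  obtain ⟨D, hD, hk⟩ := h
  exact ⟨D, hC.trans hD, hk⟩

theorem not_pebbSolvable_zero (r : V) : ¬ PebbSolvable G 0 r 1 := by
  rintro ⟨C', hC', hk⟩
  rcases hC'.cases_head with rfl | ⟨D, ⟨u, v, -, h2, -⟩, -⟩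
  · simp at hk
  · simp at h2

theorem reflTransGen_pebblingStep_single_of_adj {u v : V} (h : G.Adj u v) (m : ℕ) :
    Relation.ReflTransGen (PebblingStep G) (Pi.single u (2 * m)) (Pi.single v m) := by
  induction m with
  | zero => simpa using Relation.ReflTransGen.refl
  | succ m ih =>
    rw [mul_add, Pi.single_add, Pi.single_add]
    refine reflTransGen_pebblingStep_add ih (.single ?_)
    simpa using pebblingStep_add_single h 0

theorem reflTransGen_pebblingStep_single_of_walk {u v : V} (p : G.Walk u v) :
    Relation.ReflTransGen (PebblingStep G) (Pi.single u (2 ^ p.length)) (Pi.single v 1) := by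
  induction p with
  | nil => simpa using Relation.ReflTransGen.refl
  | cons h p ih =>
    rw [SimpleGraph.Walk.length_cons, pow_succ']
    exact (reflTransGen_pebblingStep_single_of_adj h _).trans ih

end Moves

section Bounds

variable {V W : Type*} [Fintype V] [DecidableEq V] [Fintype W] [DecidableEq W]
  {G : SimpleGraph V} {H : SimpleGraph W}

/-- Every configuration of size at least `n` on `G` can reach every root. -/
def IsPebblingBound (G : SimpleGraph V) (n : ℕ) : Prop :=
  ∀ (r : V) (C : V → ℕ), n ≤ ∑ v, C v → PebbSolvable G C r 1

theorem IsPebblingBound.pebblingNumber_le {n : ℕ} (h : IsPebblingBound G n) :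
    pebblingNumber G ≤ n :=
  Nat.sInf_le h

theorem isPebblingBound_of_connected (hG : G.Connected) :
    IsPebblingBound G (Fintype.card V * 2 ^ Fintype.card V) := by
  intro r C hC
  obtain ⟨u, -, hu⟩ := Finset.exists_le_of_sum_le (s := Finset.univ)
    (f := fun _ : V => 2 ^ Fintype.card V) (g := C) ⟨r, Finset.mem_univ r⟩ (by simpa using hC)
  obtain ⟨p, hp⟩ := (hG.preconnected u r).exists_isPath
  refine PebbSolvable.mono
    ⟨_, reflTransGen_pebblingStep_single_of_walk p, by simp⟩ ?_
  intro v
  by_cases hv : v = u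
  · subst hv
    simpa using (Nat.pow_le_pow_right two_pos hp.length_lt.le).trans hu
  · simp [hv]

theorem isPebblingBound_pebblingNumber (hG : G.Connected) :
    IsPebblingBound G (pebblingNumber G) :=
  Nat.sInf_mem (s := {n | IsPebblingBound G n}) ⟨_, isPebblingBound_of_connected hG⟩

theorem IsPebblingBound.pebbSolvable {n : ℕ} (h : IsPebblingBound G n) (r : V) (t : ℕ)
    {C : V → ℕ} (hC : t * n ≤ ∑ v, C v) : PebbSolvable G C r t := by
  induction t generalizing C with
  | zero => exact ⟨C, .refl, Nat.zero_le _⟩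
  | succ t ih =>
    rw [add_mul, one_mul] at hC
    obtain ⟨D, hD, hn⟩ := exists_le_sum_eq (show n ≤ ∑ v, C v by omega)
    have hsum : ∑ v, (C - D) v + ∑ v, D v = ∑ v, C v := by
      rw [← Finset.sum_add_distrib]
      exact Finset.sum_congr rfl fun v _ => Nat.sub_add_cancel (hD v)
    have := (ih (C := C - D) (by omega)).add (h r D hn.ge)
    rwa [tsub_add_cancel_of_le hD] at this

theorem IsPebblingBound.pos [Nonempty V] {n : ℕ} (h : IsPebblingBound G n) : 0 < n := by
  by_contra! hn
  obtain ⟨r⟩ := ‹Nonempty V›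
  exact not_pebbSolvable_zero r (h r 0 (by simpa using hn))

theorem IsPebblingBound.boxProd {a b : ℕ} (hG : IsPebblingBound G a) (hH : IsPebblingBound H b) :
    IsPebblingBound (G □ H) ((a + Fintype.card V) * b) := by
  rintro ⟨g, h⟩ C hC
  have : Nonempty W := ⟨h⟩
  have hb : 0 < b := hH.pos
  let size (x : V) : ℕ := ∑ y, C (x, y)
  let F (x : V) : ℕ := size x / b
  choose D hD hFD using fun x : V =>
    hH.pebbSolvable h (F x) (C := fun y => C (x, y)) (Nat.div_mul_le_self _ _)
  let ι (x : V) : H →g G □ H := (SimpleGraph.boxProdRight G H x).toHom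
  have hι (x : V) : Function.Injective (ι x) := (SimpleGraph.boxProdRight G H x).injective
  let κ : G →g G □ H := (SimpleGraph.boxProdLeft G H h).toHom
  have hκ : Function.Injective κ := (SimpleGraph.boxProdLeft G H h).injective
  have hCsum : C = ∑ x, pushConfig (ι x) (fun y => C (x, y)) := by
    funext ⟨x, y⟩
    rw [Finset.sum_apply, Finset.sum_eq_single x]
    · exact (pushConfig_apply (hι x) (fun y => C (x, y)) y).symm
    · intro x' _ hx
      exact Finset.sum_eq_zero fun z _ => if_neg fun e => hx (congrArg Prod.fst e)
    · simp
  have hmove : Relation.ReflTransGen (PebblingStep (G □ H)) C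
      (∑ x, pushConfig (ι x) (D x)) := by
    rw [hCsum]
    exact reflTransGen_pebblingStep_sum _ fun x => (hD x).lift _ fun _ _ h => h.push (ι x)
  have hF : a ≤ ∑ x, F x := by
    have hlt : ∑ x, size x ≤ (∑ x, F x) * b + Fintype.card V * b := by
      rw [← Finset.card_univ, ← smul_eq_mul (Finset.card _), ← Finset.sum_const, Finset.sum_mul,
        ← Finset.sum_add_distrib]
      refine Finset.sum_le_sum fun x _ => ?_
      have := Nat.div_add_mod' (size x) b
      have := Nat.mod_lt (size x) hb
      simp only [F]
      omega
    rw [Fintype.sum_prod_type] at hC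
    have := hC.trans hlt
    rw [← add_mul] at this
    have := Nat.le_of_mul_le_mul_right this hb
    omega
  refine PebbSolvable.of_reflTransGen hmove (((hG g F hF).push κ hκ).mono ?_)
  rintro ⟨x, y⟩
  by_cases hy : y = h
  · subst hy
    calc pushConfig κ F (x, y) = F x := pushConfig_apply hκ F x
      _ ≤ D x y := hFD x
      _ = pushConfig (ι x) (D x) (x, y) := (pushConfig_apply (hι x) (D x) y).symm
      _ ≤ (∑ z, pushConfig (ι z) (D z)) (x, y) := by
        rw [Finset.sum_apply]
        exact Finset.single_le_sum (f := fun z => pushConfig (ι z) (D z) (x, y))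
          (fun _ _ => Nat.zero_le _) (Finset.mem_univ x)
  · have : pushConfig κ F (x, y) = 0 :=
      Finset.sum_eq_zero fun z _ => if_neg fun e => hy (congrArg Prod.snd e).symm
    rw [this]
    exact Nat.zero_le _

theorem IsPebblingBound.boxPow {a : ℕ} (hG : IsPebblingBound G a) (n : ℕ) :
    IsPebblingBound (boxPow G n) ((a + Fintype.card V) ^ n * a) := by
  induction n with
  | zero =>
    rw [pow_zero, one_mul]
    exact hG
  | succ n ih =>
    rw [pow_succ', mul_assoc]
    exact hG.boxProd ih

end Bounds

/-- For every connected graph `G` and positive integer `k`,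
`π(G^{□k}) < (π(G) + |G|)^k`, where `G^{□k}` is the product of `k` copies of `G`. -/
theorem pebblingNumber_boxPow_lt {V : Type u} [Fintype V] [DecidableEq V]
    (G : SimpleGraph V) (hG : G.Connected) (k : ℕ) (hk : 1 ≤ k) :
    pebblingNumber (boxPow G (k - 1)) < (pebblingNumber G + Fintype.card V) ^ k := by
  obtain ⟨n, rfl⟩ := Nat.exists_eq_add_of_le' hk
  have : Nonempty V := hG.nonempty
  have hcard : 0 < Fintype.card V := Fintype.card_pos
  refine ((isPebblingBound_pebblingNumber hG).boxPow n).pebblingNumber_le.trans_lt ?_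
  rw [pow_succ]
  exact Nat.mul_lt_mul_of_pos_left (by omega) (by positivity)
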